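/- For every α ∈ ℝ, (4/7)·∫_0^∞ λ^{−1}·exp( −λ²/7 + (8α/7)·λ )·( ∫_0^λ exp( μ²/7 − (8α/7)·μ ) dμ ) dλ = π^{3/2}/√7 + (1/√7)·Σ_{m≥1} ( Γ((m+1)/2) / m! )·( 8α/√7 )^m · t_m, where t_m := Σ_{k≥0} 2 / ( ((m+1)/2 + 2k)·((m+3)/2 + 2k) ). Moreover t_m = H_{(m−1)/4} − H_{(m−3)/4}, where H_x := Σ_{k≥1} ( 1/k − 1/(k+x) ) for x > −1. -/

import Mathlib

open MeasureTheory Filter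
open scoped Topology

noncomputable section

/-- The generalized harmonic number `H_x = Σ_{k≥1} (1/k - 1/(k+x))`, `x > -1`. -/
def harmonicGen (x : ℝ) : ℝ :=
  ∑' k : ℕ, (1 / ((k : ℝ) + 1) - 1 / (((k : ℝ) + 1) + x))

/-- `t_m = Σ_{k≥0} 2 / (((m+1)/2 + 2k) ((m+3)/2 + 2k))`. -/
def tSeq (m : ℕ) : ℝ :=
  ∑' k : ℕ, 2 / ((((m : ℝ) + 1) / 2 + 2 * (k : ℝ)) * (((m : ℝ) + 3) / 2 + 2 * (k : ℝ)))

theorem summable_one_div_add_mul_add {a b : ℝ} (ha : 0 < a) (hb : 0 < b) :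
    Summable fun k : ℕ => 1 / (((k : ℝ) + a) * ((k : ℝ) + b)) := by
  have h : ∀ c : ℝ, Summable fun k : ℕ => 1 / ((k : ℝ) + c) ^ 2 := by
    intro c
    simpa [sq_abs] using (Real.summable_one_div_nat_add_rpow c 2).2 (by norm_num)
  refine Summable.of_nonneg_of_le (fun k => by positivity) (fun k => ?_) ((h a).add (h b))
  have hx : 0 < (k : ℝ) + a := by positivity
  have hy : 0 < (k : ℝ) + b := by positivity
  have e : 1 / (((k : ℝ) + a) * ((k : ℝ) + b)) = (1 / ((k : ℝ) + a)) * (1 / ((k : ℝ) + b)) := by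
    field_simp
  rw [e, ← one_div_pow, ← one_div_pow]
  nlinarith [sq_nonneg (1 / ((k : ℝ) + a) - 1 / ((k : ℝ) + b)), sq_nonneg (1 / ((k : ℝ) + a)),
    sq_nonneg (1 / ((k : ℝ) + b))]

theorem summable_harmonicGen {x : ℝ} (hx : -1 < x) :
    Summable fun k : ℕ => 1 / ((k : ℝ) + 1) - 1 / (((k : ℝ) + 1) + x) := by
  have h : 0 < 1 + x := by linarith
  refine ((summable_one_div_add_mul_add one_pos h).mul_left x).congr fun k => ?_
  have h1 : (0 : ℝ) < k + 1 := by positivity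
  have h2 : (0 : ℝ) < k + (1 + x) := by positivity
  have h3 : (0 : ℝ) < k + 1 + x := by linarith
  rw [add_assoc] at h3 ⊢
  field_simp
  ring

theorem tSeq_eq_harmonicGen_sub (m : ℕ) :
    tSeq m = harmonicGen (((m : ℝ) - 1) / 4) - harmonicGen (((m : ℝ) - 3) / 4) := by
  have hm : (0 : ℝ) ≤ m := by positivity
  rw [tSeq, harmonicGen, harmonicGen,
    ← (summable_harmonicGen (by linarith)).tsum_sub (summable_harmonicGen (by linarith))]
  refine tsum_congr fun k => ?_
  have hk : (0 : ℝ) ≤ k := by positivity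
  have h1 : ((k : ℝ) + 1 + ((m : ℝ) - 1) / 4) ≠ 0 := by linarith
  have h2 : ((k : ℝ) + 1 + ((m : ℝ) - 3) / 4) ≠ 0 := by linarith
  have h3 : ((m : ℝ) + 1) / 2 + 2 * (k : ℝ) = 2 * ((k : ℝ) + 1 + ((m : ℝ) - 3) / 4) := by ring
  have h4 : ((m : ℝ) + 3) / 2 + 2 * (k : ℝ) = 2 * ((k : ℝ) + 1 + ((m : ℝ) - 1) / 4) := by ring
  have h5 : 1 / ((k : ℝ) + 1 + ((m : ℝ) - 3) / 4) - 1 / ((k : ℝ) + 1 + ((m : ℝ) - 1) / 4)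
      = (1 / 2) / (((k : ℝ) + 1 + ((m : ℝ) - 3) / 4) * ((k : ℝ) + 1 + ((m : ℝ) - 1) / 4)) := by
    rw [div_sub_div _ _ h2 h1]
    congr 1
    ring
  rw [h3, h4, sub_sub_sub_cancel_left, h5]
  field_simp

theorem integral_pow_div_one_add_sq (m : ℕ) :
    ∫ s in (0 : ℝ)..1, s ^ m / (1 + s ^ 2) = tSeq m / 4 := by
  have hm : (0 : ℝ) ≤ m := by positivity
  let F : ℕ → ℝ → ℝ := fun k s => s ^ (m + 4 * k) - s ^ (m + 4 * k + 2)
  have hF : ∀ k, IntegrableOn (F k) (Set.Ioo 0 1) := fun k =>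
    ((by fun_prop : Continuous (F k)).integrableOn_Icc).mono_set Set.Ioo_subset_Icc_self
  have hI : ∀ k, ∫ s in Set.Ioo (0 : ℝ) 1, F k s =
      (2 / ((((m : ℝ) + 1) / 2 + 2 * (k : ℝ)) * (((m : ℝ) + 3) / 2 + 2 * (k : ℝ)))) / 4 := by
    intro k
    rw [← integral_Ioc_eq_integral_Ioo, ← intervalIntegral.integral_of_le zero_le_one]
    rw [intervalIntegral.integral_sub (by simp) (by simp), integral_pow, integral_pow]
    push_cast
    simp
    have h1 : (m : ℝ) + 4 * k + 1 ≠ 0 := by positivity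
    have h2 : (m : ℝ) + 4 * k + 2 + 1 ≠ 0 := by positivity
    have h3 : ((m : ℝ) + 1) / 2 + 2 * k = ((m : ℝ) + 4 * k + 1) / 2 := by ring
    have h4 : ((m : ℝ) + 3) / 2 + 2 * k = ((m : ℝ) + 4 * k + 2 + 1) / 2 := by ring
    rw [h3, h4]
    field_simp
    ring
  have hN : ∀ k, ∫ s in Set.Ioo (0 : ℝ) 1, ‖F k s‖ = ∫ s in Set.Ioo (0 : ℝ) 1, F k s := by
    intro k
    refine setIntegral_congr_fun measurableSet_Ioo fun s hs => ?_
    exact Real.norm_of_nonneg (sub_nonneg.2 (pow_le_pow_of_le_one hs.1.le hs.2.le (by omega)))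
  have hS : Summable fun k : ℕ =>
      2 / ((((m : ℝ) + 1) / 2 + 2 * (k : ℝ)) * (((m : ℝ) + 3) / 2 + 2 * (k : ℝ))) := by
    refine ((summable_one_div_add_mul_add (a := ((m : ℝ) + 1) / 4) (b := ((m : ℝ) + 3) / 4)
      (by positivity) (by positivity)).mul_left (1 / 2)).congr fun k => ?_
    field_simp
    ring
  have key := hasSum_integral_of_summable_integral_norm hF (by
    simp_rw [hN, hI]
    exact hS.div_const 4)
  simp_rw [hI] at key
  rw [intervalIntegral.integral_of_le zero_le_one, integral_Ioc_eq_integral_Ioo, tSeq,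
    ← tsum_div_const, key.tsum_eq]
  refine setIntegral_congr_fun measurableSet_Ioo fun s hs => ?_
  have hs4 : s ^ 4 < 1 := pow_lt_one₀ hs.1.le hs.2 (by norm_num)
  have hg := (hasSum_geometric_of_lt_one (by positivity) hs4).mul_left (s ^ m * (1 - s ^ 2))
  have hF' : ∀ k, F k s = s ^ m * (1 - s ^ 2) * (s ^ 4) ^ k := fun k => by
    simp only [F]; ring
  simp_rw [hF', hg.tsum_eq]
  have h1 : 1 - s ^ 4 ≠ 0 := by linarith
  have h2 : 1 + s ^ 2 ≠ 0 := by positivity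
  field_simp
  ring

theorem tSeq_zero : tSeq 0 = Real.pi := by
  have h := integral_pow_div_one_add_sq 0
  simp only [pow_zero, integral_one_div_one_add_sq, Real.arctan_one, Real.arctan_zero] at h
  linarith

theorem integrable_exp_neg_sq_add_mul (c : ℝ) :
    Integrable fun x : ℝ => Real.exp (-x ^ 2 + c * x) := by
  refine ((integrable_exp_neg_mul_sq (b := 1 / 2) (by norm_num)).const_mul
    (Real.exp (c ^ 2 / 2))).mono' (by fun_prop) (Eventually.of_forall fun x => ?_)
  rw [Real.norm_of_nonneg (Real.exp_nonneg _), ← Real.exp_add, Real.exp_le_exp]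
  nlinarith [sq_nonneg (x - c)]

theorem integrableOn_pow_mul_exp_neg_sq (m : ℕ) :
    IntegrableOn (fun x : ℝ => x ^ m * Real.exp (-x ^ 2)) (Set.Ioi 0) := by
  have h := integrableOn_rpow_mul_exp_neg_rpow (p := 2) (s := m)
    (by have : (0 : ℝ) ≤ m := by positivity
        linarith) two_pos
  simpa using h

theorem integral_pow_mul_exp_neg_sq (m : ℕ) :
    ∫ x in Set.Ioi (0 : ℝ), x ^ m * Real.exp (-x ^ 2) = Real.Gamma (((m : ℝ) + 1) / 2) / 2 := by
  have h := integral_rpow_mul_exp_neg_rpow (p := 2) (q := m) two_pos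
    (by have : (0 : ℝ) ≤ m := by positivity
        linarith)
  simp only [Real.rpow_natCast, Real.rpow_two] at h
  rw [h]
  ring

theorem hasSum_pow_div_factorial_exp (x : ℝ) :
    HasSum (fun m : ℕ => x ^ m / (m.factorial : ℝ)) (Real.exp x) := by
  rw [Real.exp_eq_exp_ℝ]
  exact NormedSpace.expSeries_div_hasSum_exp x

theorem summable_pow_div_factorial_mul_Gamma {c : ℝ} (hc : 0 ≤ c) :
    Summable fun m : ℕ => c ^ m / (m.factorial : ℝ) * (Real.Gamma (((m : ℝ) + 1) / 2) / 2) := by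
  refine summable_of_sum_le (c := ∫ x in Set.Ioi (0 : ℝ), Real.exp (-x ^ 2 + c * x))
    (fun m => ?_) fun u => ?_
  · have := Real.Gamma_pos_of_pos (s := ((m : ℝ) + 1) / 2) (by positivity)
    positivity
  · simp_rw [← integral_pow_mul_exp_neg_sq, ← integral_const_mul]
    rw [← integral_finsetSum _ fun m _ => (integrableOn_pow_mul_exp_neg_sq m).const_mul _]
    refine setIntegral_mono_on
      (integrable_finsetSum _ fun m _ => (integrableOn_pow_mul_exp_neg_sq m).const_mul _)
      (integrable_exp_neg_sq_add_mul c).integrableOn measurableSet_Ioi fun x hx => ?_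
    have hx' : 0 ≤ x := le_of_lt hx
    rw [add_comm, Real.exp_add]
    have h := sum_le_hasSum u (fun m _ => by positivity) (hasSum_pow_div_factorial_exp (c * x))
    refine le_trans (le_of_eq ?_) (mul_le_mul_of_nonneg_right h (Real.exp_nonneg (-x ^ 2)))
    rw [Finset.sum_mul]
    refine Finset.sum_congr rfl fun m _ => ?_
    ring

theorem hasSum_integral_exp_neg_sq_add_mul (c : ℝ) :
    HasSum (fun m : ℕ => c ^ m / (m.factorial : ℝ) * (Real.Gamma (((m : ℝ) + 1) / 2) / 2))
      (∫ x in Set.Ioi (0 : ℝ), Real.exp (-x ^ 2 + c * x)) := by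
  have key := hasSum_integral_of_summable_integral_norm (μ := volume.restrict (Set.Ioi (0 : ℝ)))
    (F := fun (m : ℕ) x => c ^ m / (m.factorial : ℝ) * (x ^ m * Real.exp (-x ^ 2)))
    (fun m => (integrableOn_pow_mul_exp_neg_sq m).const_mul _) (by
      refine (summable_pow_div_factorial_mul_Gamma (abs_nonneg c)).congr fun m => ?_
      rw [← integral_pow_mul_exp_neg_sq, ← integral_const_mul]
      refine setIntegral_congr_fun measurableSet_Ioi fun x hx => ?_
      have hx' : 0 < x := hx
      simp [abs_of_pos hx'])
  have hE : ∀ x : ℝ, ∑' m : ℕ, c ^ m / (m.factorial : ℝ) * (x ^ m * Real.exp (-x ^ 2))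
      = Real.exp (-x ^ 2 + c * x) := fun x => by
    rw [add_comm, Real.exp_add, ← ((hasSum_pow_div_factorial_exp (c * x)).mul_right _).tsum_eq]
    refine tsum_congr fun m => ?_
    ring
  simp_rw [hE, integral_const_mul, integral_pow_mul_exp_neg_sq] at key
  exact key

theorem hasSum_integral_div_one_add_sq (b : ℝ) :
    HasSum (fun m : ℕ => b ^ m / (m.factorial : ℝ) * (Real.Gamma (((m : ℝ) + 1) / 2) / 2)
        * (tSeq m / 4))
      (∫ s in Set.Ioo (0 : ℝ) 1, (∫ x in Set.Ioi (0 : ℝ), Real.exp (-x ^ 2 + b * s * x))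
        / (1 + s ^ 2)) := by
  let a : ℕ → ℝ := fun m => b ^ m / (m.factorial : ℝ) * (Real.Gamma (((m : ℝ) + 1) / 2) / 2)
  have hc : ∀ m : ℕ, Continuous fun s : ℝ => s ^ m / (1 + s ^ 2) := fun m =>
    (by fun_prop : Continuous fun s : ℝ => s ^ m).div (by fun_prop) fun s => by positivity
  have hi : ∀ m : ℕ, IntegrableOn (fun s : ℝ => s ^ m / (1 + s ^ 2)) (Set.Ioo 0 1) := fun m =>
    ((hc m).integrableOn_Icc).mono_set Set.Ioo_subset_Icc_self
  have hI : ∀ m : ℕ, ∫ s in Set.Ioo (0 : ℝ) 1, s ^ m / (1 + s ^ 2) = tSeq m / 4 := fun m => by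
    rw [← integral_pow_div_one_add_sq, intervalIntegral.integral_of_le zero_le_one,
      integral_Ioc_eq_integral_Ioo]
  have key := hasSum_integral_of_summable_integral_norm
    (μ := volume.restrict (Set.Ioo (0 : ℝ) 1))
    (F := fun (m : ℕ) s => a m * (s ^ m / (1 + s ^ 2)))
    (fun m => (hi m).const_mul _) (by
      refine Summable.of_nonneg_of_le (fun m => integral_nonneg fun s => norm_nonneg _)
        (fun m => ?_) (summable_pow_div_factorial_mul_Gamma (abs_nonneg b))
      have hG := Real.Gamma_pos_of_pos (s := ((m : ℝ) + 1) / 2) (by positivity)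
      have h := norm_setIntegral_le_of_norm_le_const (μ := volume) (s := Set.Ioo (0 : ℝ) 1)
        (f := fun s => ‖a m * (s ^ m / (1 + s ^ 2))‖) (C := |a m|) (by simp) (fun s hs => by
          rw [norm_norm, norm_mul, Real.norm_eq_abs]
          refine mul_le_of_le_one_right (abs_nonneg _) ?_
          have h0 : 0 ≤ s := hs.1.le
          rw [Real.norm_of_nonneg (by positivity), div_le_one (by positivity)]
          have : s ^ m ≤ 1 := pow_le_one₀ hs.1.le hs.2.le
          nlinarith [sq_nonneg s])
      rw [Real.norm_of_nonneg (integral_nonneg fun s => norm_nonneg _)] at h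
      refine h.trans (le_of_eq ?_)
      simp [a, abs_mul, abs_div, abs_of_pos hG])
  have hE : ∀ s : ℝ, ∑' m : ℕ, a m * (s ^ m / (1 + s ^ 2))
      = (∫ x in Set.Ioi (0 : ℝ), Real.exp (-x ^ 2 + b * s * x)) / (1 + s ^ 2) := fun s => by
    rw [← (hasSum_integral_exp_neg_sq_add_mul (b * s)).tsum_eq, ← tsum_div_const]
    refine tsum_congr fun m => ?_
    simp only [a]
    ring
  simp_rw [hE, integral_const_mul, hI] at key
  exact key

theorem integrableOn_integral_exp_div_one_add_sq (b : ℝ) :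
    IntegrableOn (fun s : ℝ => (∫ x in Set.Ioi (0 : ℝ), Real.exp (-x ^ 2 + b * s * x))
      / (1 + s ^ 2)) (Set.Ioo 0 1) := by
  have hm : StronglyMeasurable fun s : ℝ =>
      ∫ x in Set.Ioi (0 : ℝ), Real.exp (-x ^ 2 + b * s * x) :=
    StronglyMeasurable.integral_prod_right'
      (f := fun z : ℝ × ℝ => Real.exp (-z.2 ^ 2 + b * z.1 * z.2))
      (by fun_prop : Continuous _).stronglyMeasurable
  refine IntegrableOn.of_bound (by simp)
    (hm.measurable.div (by fun_prop)).aestronglyMeasurable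
    (∫ x in Set.Ioi (0 : ℝ), Real.exp (-x ^ 2 + |b| * x))
    (ae_restrict_of_forall_mem measurableSet_Ioo fun s hs => ?_)
  have h0 : 0 ≤ ∫ x in Set.Ioi (0 : ℝ), Real.exp (-x ^ 2 + b * s * x) :=
    integral_nonneg fun x => Real.exp_nonneg _
  rw [Real.norm_of_nonneg (by positivity)]
  refine (div_le_self h0 (by nlinarith [sq_nonneg s])).trans ?_
  refine setIntegral_mono_on (integrable_exp_neg_sq_add_mul _).integrableOn
    (integrable_exp_neg_sq_add_mul _).integrableOn measurableSet_Ioi fun x hx => ?_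
  have hx' : 0 < x := hx
  have hbs : b * s ≤ |b| := by
    calc b * s ≤ |b| * s := mul_le_mul_of_nonneg_right (le_abs_self b) hs.1.le
      _ ≤ |b| := mul_le_of_le_one_right (abs_nonneg b) hs.2.le
  gcongr

/-- The integrand obtained from the substitution `v = l * (1 - s ^ 2) / (1 + s ^ 2)`. -/
def substitutedIntegrand (b l s : ℝ) : ℝ :=
  Real.exp (-(2 * s / (Real.sqrt 7 * (1 + s ^ 2)) * l) ^ 2
    + b * s * (2 * s / (Real.sqrt 7 * (1 + s ^ 2)) * l)) * (4 * s / (1 + s ^ 2) ^ 2)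

theorem continuous_substitutedIntegrand (b : ℝ) :
    Continuous (Function.uncurry (substitutedIntegrand b)) := by
  have h1 : ∀ z : ℝ × ℝ, Real.sqrt 7 * (1 + z.2 ^ 2) ≠ 0 := fun z => by positivity
  have h2 : ∀ z : ℝ × ℝ, (1 + z.2 ^ 2) ^ 2 ≠ 0 := fun z => by positivity
  unfold Function.uncurry substitutedIntegrand
  fun_prop (disch := assumption)

theorem integrableOn_substitutedIntegrand (b : ℝ) {s : ℝ} (hs : 0 < s) :
    IntegrableOn (fun l => substitutedIntegrand b l s) (Set.Ioi 0) := by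
  have hp : 0 < 2 * s / (Real.sqrt 7 * (1 + s ^ 2)) := by positivity
  have h := (integrableOn_Ioi_comp_mul_left_iff
    (fun x : ℝ => Real.exp (-x ^ 2 + b * s * x)) 0 hp).2
    (integrable_exp_neg_sq_add_mul _).integrableOn
  exact h.mul_const _

theorem integral_substitutedIntegrand (b : ℝ) {s : ℝ} (hs : 0 < s) :
    ∫ l in Set.Ioi (0 : ℝ), substitutedIntegrand b l s =
      2 * Real.sqrt 7 * ((∫ x in Set.Ioi (0 : ℝ), Real.exp (-x ^ 2 + b * s * x))
        / (1 + s ^ 2)) := by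
  have hp : 0 < 2 * s / (Real.sqrt 7 * (1 + s ^ 2)) := by positivity
  have h := integral_comp_mul_left_Ioi
    (fun x : ℝ => Real.exp (-x ^ 2 + b * s * x)) 0 hp
  unfold substitutedIntegrand
  rw [integral_mul_const, h, mul_zero, smul_eq_mul]
  field_simp
  ring

theorem setIntegral_substitutedIntegrand (α : ℝ) {l : ℝ} (hl : 0 < l) :
    l⁻¹ * Real.exp (-l ^ 2 / 7 + (8 * α / 7) * l) *
        ∫ v in (0 : ℝ)..l, Real.exp (v ^ 2 / 7 - (8 * α / 7) * v)
      = ∫ s in Set.Ioo (0 : ℝ) 1, substitutedIntegrand (8 * α / Real.sqrt 7) l s := by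
  have hne : ∀ s : ℝ, 1 + s ^ 2 ≠ 0 := fun s => by positivity
  have hne2 : ∀ s : ℝ, (1 + s ^ 2) ^ 2 ≠ 0 := fun s => by positivity
  have hd : ∀ s : ℝ, HasDerivAt (fun s : ℝ => l * (1 - s ^ 2) / (1 + s ^ 2))
      (-(4 * l * s) / (1 + s ^ 2) ^ 2) s := by
    intro s
    have h1 : HasDerivAt (fun s : ℝ => l * (1 - s ^ 2)) (l * (-(2 * s))) s := by
      simpa using (((hasDerivAt_pow 2 s).const_sub 1).const_mul l)
    have h2 : HasDerivAt (fun s : ℝ => 1 + s ^ 2) (2 * s) s := by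
      simpa using (hasDerivAt_pow 2 s).const_add 1
    exact (h1.div h2 (hne s)).congr_deriv (by ring)
  have hsub := intervalIntegral.integral_comp_mul_deriv (a := 0) (b := 1)
    (g := fun v => Real.exp (v ^ 2 / 7 - (8 * α / 7) * v)) (fun s _ => hd s)
    (Continuous.continuousOn (by fun_prop (disch := assumption))) (by fun_prop)
  simp only [Function.comp_apply] at hsub
  norm_num at hsub
  rw [intervalIntegral.integral_symm 0 l] at hsub
  rw [← integral_Ioc_eq_integral_Ioo, ← intervalIntegral.integral_of_le zero_le_one,
    ← neg_eq_iff_eq_neg.2 hsub, ← intervalIntegral.integral_neg,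
    ← intervalIntegral.integral_const_mul]
  refine intervalIntegral.integral_congr fun s _ => ?_
  simp only [substitutedIntegrand]
  have h7 : Real.sqrt 7 ^ 2 = 7 := Real.sq_sqrt (by norm_num)
  have hs := hne s
  have e : -(2 * s / (Real.sqrt 7 * (1 + s ^ 2)) * l) ^ 2
      + 8 * α / Real.sqrt 7 * s * (2 * s / (Real.sqrt 7 * (1 + s ^ 2)) * l)
      = (-l ^ 2 / 7 + (8 * α / 7) * l) + ((l * (1 - s ^ 2) / (1 + s ^ 2)) ^ 2 / 7
        - (8 * α / 7) * (l * (1 - s ^ 2) / (1 + s ^ 2))) := by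
    field_simp
    rw [h7]
    ring
  rw [e, Real.exp_add (-l ^ 2 / 7 + (8 * α / 7) * l)]
  generalize Real.exp (-l ^ 2 / 7 + (8 * α / 7) * l) = A
  generalize Real.exp ((l * (1 - s ^ 2) / (1 + s ^ 2)) ^ 2 / 7
    - (8 * α / 7) * (l * (1 - s ^ 2) / (1 + s ^ 2))) = B
  field_simp

theorem integral_absorption_eq (α : ℝ) :
    ∫ l in Set.Ioi (0 : ℝ), l⁻¹ * Real.exp (-l ^ 2 / 7 + (8 * α / 7) * l) *
        ∫ v in (0 : ℝ)..l, Real.exp (v ^ 2 / 7 - (8 * α / 7) * v)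
      = 2 * Real.sqrt 7 * ∫ s in Set.Ioo (0 : ℝ) 1,
        (∫ x in Set.Ioi (0 : ℝ), Real.exp (-x ^ 2 + 8 * α / Real.sqrt 7 * s * x))
          / (1 + s ^ 2) := by
  rw [setIntegral_congr_fun measurableSet_Ioi fun l hl => setIntegral_substitutedIntegrand α hl,
    integral_integral_swap, ← integral_const_mul]
  · exact setIntegral_congr_fun measurableSet_Ioo fun s hs => integral_substitutedIntegrand _ hs.1
  · refine (integrable_prod_iff'
      (continuous_substitutedIntegrand _).aestronglyMeasurable).2 ⟨?_, ?_⟩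
    · exact ae_restrict_of_forall_mem measurableSet_Ioo fun s hs =>
        integrableOn_substitutedIntegrand _ hs.1
    · refine IntegrableOn.congr_fun ((integrableOn_integral_exp_div_one_add_sq
        (8 * α / Real.sqrt 7)).const_mul (2 * Real.sqrt 7)) (fun s hs => ?_) measurableSet_Ioo
      rw [← integral_substitutedIntegrand _ hs.1]
      refine setIntegral_congr_fun measurableSet_Ioi fun l _ => ?_
      have h0 : 0 < s := hs.1
      refine (Real.norm_of_nonneg ?_).symm
      simp only [substitutedIntegrand]
      positivity

/-- Series representation of the expected absorption time:
`(4/7)∫_0^∞ λ⁻¹ e^{-λ²/7 + (8α/7)λ} (∫_0^λ e^{μ²/7 - (8α/7)μ} dμ) dλ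
  = π^{3/2}/√7 + (1/√7) Σ_{m≥1} (Γ((m+1)/2)/m!) (8α/√7)^m t_m`,
and `t_m = H_{(m-1)/4} - H_{(m-3)/4}` for every `m ∈ ℕ`. -/
theorem expected_absorption_time_series_representation (α : ℝ) :
    ((4 : ℝ) / 7) * (∫ l in Set.Ioi (0 : ℝ),
        l⁻¹ * Real.exp (-l ^ 2 / 7 + (8 * α / 7) * l) *
          ∫ v in (0 : ℝ)..l, Real.exp (v ^ 2 / 7 - (8 * α / 7) * v))
      = Real.pi ^ ((3 : ℝ) / 2) / Real.sqrt 7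
        + (1 / Real.sqrt 7) * ∑' m : ℕ,
            (Real.Gamma ((((m : ℝ) + 1) + 1) / 2) / (Nat.factorial (m + 1) : ℝ))
              * (8 * α / Real.sqrt 7) ^ (m + 1) * tSeq (m + 1) ∧
    ∀ m : ℕ, tSeq m = harmonicGen (((m : ℝ) - 1) / 4) - harmonicGen (((m : ℝ) - 3) / 4) := by
  refine ⟨?_, tSeq_eq_harmonicGen_sub⟩
  have key := hasSum_integral_div_one_add_sq (8 * α / Real.sqrt 7)
  have h7 : Real.sqrt 7 ^ 2 = 7 := Real.sq_sqrt (by norm_num)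
  have hpi : Real.pi ^ ((3 : ℝ) / 2) = Real.sqrt Real.pi * Real.pi := by
    rw [show (3 : ℝ) / 2 = 1 / 2 + 1 by norm_num, Real.rpow_add Real.pi_pos, Real.rpow_one,
      Real.sqrt_eq_rpow]
  rw [integral_absorption_eq, ← key.tsum_eq, key.summable.tsum_eq_zero_add, hpi]
  have hT : ∀ m : ℕ, (8 * α / Real.sqrt 7) ^ (m + 1) / ((m + 1).factorial : ℝ)
      * (Real.Gamma ((((m + 1 : ℕ) : ℝ) + 1) / 2) / 2) * (tSeq (m + 1) / 4)
      = (1 / 8) * ((Real.Gamma ((((m : ℝ) + 1) + 1) / 2) / (Nat.factorial (m + 1) : ℝ))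
        * (8 * α / Real.sqrt 7) ^ (m + 1) * tSeq (m + 1)) := by
    intro m
    push_cast
    ring
  simp_rw [hT, tsum_mul_left]
  simp only [tSeq_zero, pow_zero, Nat.factorial_zero, Nat.cast_one, Nat.cast_zero, zero_add,
    Real.Gamma_one_half_eq]
  set S := ∑' m : ℕ, (Real.Gamma ((((m : ℝ) + 1) + 1) / 2) / (Nat.factorial (m + 1) : ℝ))
        * (8 * α / Real.sqrt 7) ^ (m + 1) * tSeq (m + 1)
  field_simp
  rw [h7]
  ring

end
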